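/- Let k ≥ 2 be an integer. If P is a lattice polygon contained in the square [0,k]², then there exists a lattice point in ℤ² ∩ [0,k]² that cannot be inserted in P and is not a vertex of P that can be deleted from P; in other words, it is not the case that every lattice point of [0,k]² can either be inserted in P or be deleted from P as a vertex. -/

import Mathlib

open Set

/-- Points of `ℝ^d`. -/
abbrev Pt (d : ℕ) := Fin d → ℝ

/-- A polytope in `ℝ^d` is the convex hull of a finite set of points. -/
def IsPolytope (d : ℕ) (P : Set (Pt d)) : Prop :=
  ∃ S : Finset (Pt d), P = convexHull ℝ (S : Set (Pt d))

/-- A set is `d`-dimensional (full-dimensional) if its affine hull is all of `ℝ^d`. -/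
def FullDim (d : ℕ) (P : Set (Pt d)) : Prop := affineSpan ℝ P = ⊤

/-- A point `x` can be inserted in `P` when the convex hull of `P ∪ {x}` has as its
vertex set (set of extreme points) exactly the vertex set of `P` together with `x`. -/
def CanInsert (d : ℕ) (P : Set (Pt d)) (x : Pt d) : Prop :=
  Set.extremePoints ℝ (convexHull ℝ (P ∪ {x})) = Set.extremePoints ℝ P ∪ {x}

/-- A vertex `v` of `P` can be deleted from `P` when the convex hull of the remaining
vertices is `d`-dimensional. -/
def CanDelete (d : ℕ) (P : Set (Pt d)) (v : Pt d) : Prop :=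
  v ∈ Set.extremePoints ℝ P ∧
    FullDim d (convexHull ℝ (Set.extremePoints ℝ P \ {v}))

/-- `Q` is obtained from `P` by an insertion move. -/
def InsertMove (d : ℕ) (P Q : Set (Pt d)) : Prop :=
  ∃ x : Pt d, CanInsert d P x ∧ Q = convexHull ℝ (P ∪ {x})

/-- `Q` is obtained from `P` by a deletion move. -/
def DeleteMove (d : ℕ) (P Q : Set (Pt d)) : Prop :=
  ∃ v : Pt d, CanDelete d P v ∧ Q = convexHull ℝ (Set.extremePoints ℝ P \ {v})

/-- Adjacency: one polytope is obtained from the other by inserting a point or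
deleting a vertex. -/
def Move (d : ℕ) (P Q : Set (Pt d)) : Prop :=
  InsertMove d P Q ∨ DeleteMove d P Q ∨ InsertMove d Q P ∨ DeleteMove d Q P

/-- There is a path of at most `n` edges from `P` to `Q` all of whose vertices lie in
the class `C` of polytopes (i.e. `P` and `Q` are at distance at most `n` in the subgraph
induced by `C`). -/
def PathLE (d : ℕ) (C : Set (Set (Pt d))) (P Q : Set (Pt d)) (n : ℕ) : Prop :=
  ∃ (m : ℕ) (f : ℕ → Set (Pt d)), m ≤ n ∧ f 0 = P ∧ f m = Q ∧
    (∀ i ≤ m, f i ∈ C) ∧ ∀ i < m, Move d (f i) (f (i + 1))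

/-- The subgraph induced by the class `C` is connected. -/
def ConnectedIn (d : ℕ) (C : Set (Set (Pt d))) : Prop :=
  ∀ P ∈ C, ∀ Q ∈ C, ∃ n, PathLE d C P Q n

/-- The vertex set of the graph `Γ(d)`: the `d`-dimensional polytopes in `ℝ^d`. -/
def Gamma (d : ℕ) : Set (Set (Pt d)) := {P | IsPolytope d P ∧ FullDim d P}

/-- The number of vertices of a polytope. -/
noncomputable def nVerts (d : ℕ) (P : Set (Pt d)) : ℕ := (Set.extremePoints ℝ P).ncard

/-- A lattice point of `ℝ^d`. -/
def IsLatticePt (d : ℕ) (x : Pt d) : Prop := ∀ i, ∃ z : ℤ, x i = (z : ℝ)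

/-- A lattice polytope: all its vertices are lattice points. -/
def IsLatticePoly (d : ℕ) (P : Set (Pt d)) : Prop :=
  ∀ v ∈ Set.extremePoints ℝ P, IsLatticePt d v

/-- The hypercube `[0,k]^d`. -/
def Cube (d k : ℕ) : Set (Pt d) := {x | ∀ i, x i ∈ Set.Icc (0 : ℝ) (k : ℝ)}

/-- The vertex set of `Λ(d)`: the `d`-dimensional lattice polytopes in `ℝ^d`. -/
def Lambda (d : ℕ) : Set (Set (Pt d)) :=
  {P | IsPolytope d P ∧ FullDim d P ∧ IsLatticePoly d P}

/-- The vertex set of `Λ(d,k)`: the `d`-dimensional lattice polytopes in `[0,k]^d`. -/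
def LambdaK (d k : ℕ) : Set (Set (Pt d)) := {P ∈ Lambda d | P ⊆ Cube d k}

/-- A facet of a polytope `P`: an exposed face of dimension `d-1`. -/
def IsFacet (d : ℕ) (P F : Set (Pt d)) : Prop :=
  IsExposed ℝ P F ∧ F.Nonempty ∧ F ≠ P ∧
    Module.finrank ℝ ↥(vectorSpan ℝ F) = d - 1

/-- `H` is the closed half-space `H_F^-(P)` bounded by the affine hull of the facet `F`
and satisfying `P ∩ H = F`. -/
def BoundingHalfspace (d : ℕ) (P F H : Set (Pt d)) : Prop :=
  ∃ (l : (Pt d) →ₗ[ℝ] ℝ) (c : ℝ), l ≠ 0 ∧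
    H = {x | l x ≤ c} ∧
    (affineSpan ℝ F : Set (Pt d)) = {x | l x = c} ∧
    P ∩ H = F

/-- The cone `C_v(P)`: the intersection of the half-spaces `H_F^-(P)` over all facets
`F` of `P` incident to `v`. -/
def Cone (d : ℕ) (P : Set (Pt d)) (v : Pt d) : Set (Pt d) :=
  {x | ∀ F H : Set (Pt d), IsFacet d P F → v ∈ F → BoundingHalfspace d P F H → x ∈ H}

/-- A set `A` is in convex position: every finite subset of `A` is the vertex set of
a polytope, namely of its own convex hull. -/
def ConvexPosition (d : ℕ) (A : Set (Pt d)) : Prop :=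
  ∀ S : Finset (Pt d), (S : Set (Pt d)) ⊆ A →
    Set.extremePoints ℝ (convexHull ℝ (S : Set (Pt d))) = (S : Set (Pt d))

/-- The point of `ℝ²` with the given integer coordinates. -/
def intPt (x : ℤ × ℤ) : Pt 2 := ![(x.1 : ℝ), (x.2 : ℝ)]

/-- The integer points of the square `[0,k]²`. -/
def intBox (k : ℕ) : Set (ℤ × ℤ) := {x | 0 ≤ x.1 ∧ x.1 ≤ k ∧ 0 ≤ x.2 ∧ x.2 ≤ k}

/-- The determinant of two integer vectors. -/
def intDet (a b : ℤ × ℤ) : ℤ := a.1 * b.2 - a.2 * b.1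

/-- The only point of `B` in the lattice cone with apex `u` opposite to `v` and `w` is `u`. -/
def ConeFree (B : Set (ℤ × ℤ)) (u v w : ℤ × ℤ) : Prop :=
  ∀ m n : ℤ, 0 ≤ m → 0 ≤ n → u - m • (v - u) - n • (w - u) ∈ B → m = 0 ∧ n = 0

theorem ConeFree.symm {B : Set (ℤ × ℤ)} {u v w : ℤ × ℤ} (h : ConeFree B u v w) :
    ConeFree B u w v := fun m n hm hn hx =>
  (h n m hn hm (by rwa [sub_right_comm])).symm

theorem not_mem_of_coneFree_of_pos {B : Set (ℤ × ℤ)} {u v w e : ℤ × ℤ} {q r : ℤ}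
    (hv : ConeFree B v w u) (hw : ConeFree B w u v) (hvB : v ∈ B) (hwB : w ∈ B)
    (he : e = q • (v - u) + r • (w - u))
    (hprim : ∀ (n : ℤ) (y : ℤ × ℤ), e = n • y → n = 1 ∨ n = -1)
    (hext : ∀ x ∈ B, x + e ∈ B → x + e + e ∈ B ∨ x - e ∈ B)
    (hq : 0 < q) (hr : r < 0) (hadd : u + e ∈ B) : u - e ∉ B := by
  intro hsub
  have hp : q + r < 1 := by
    by_contra! hp
    have := hv (-r) (q + r - 1) (by omega) (by omega) (by
      convert hadd using 1; rw [he]; module)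
    omega
  have hp' : -1 < q + r := by
    by_contra! hp
    have := hw (-(q + r) - 1) q (by omega) (by omega) (by
      convert hsub using 1; rw [he]; module)
    omega
  obtain rfl : r = -q := by omega
  have heq : e = q • (v - w) := by rw [he]; module
  obtain rfl : q = 1 := by rcases hprim q _ heq with h | h <;> omega
  rw [one_smul] at heq
  rcases hext w hwB (by rwa [heq, add_sub_cancel]) with h | h
  · have := hv 1 0 (by omega) le_rfl (by convert h using 1; rw [heq]; module)
    omega
  · have := hw 0 1 le_rfl (by omega) (by convert h using 1; rw [heq]; module)
    omega

theorem not_mem_of_coneFree {B : Set (ℤ × ℤ)} {u v w e : ℤ × ℤ} {q r : ℤ}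
    (hu : ConeFree B u v w) (hv : ConeFree B v w u) (hw : ConeFree B w u v)
    (hvB : v ∈ B) (hwB : w ∈ B)
    (he : e = q • (v - u) + r • (w - u))
    (hprim : ∀ (n : ℤ) (y : ℤ × ℤ), e = n • y → n = 1 ∨ n = -1)
    (hext : ∀ x ∈ B, x + e ∈ B → x + e + e ∈ B ∨ x - e ∈ B)
    (hadd : u + e ∈ B) : u - e ∉ B := by
  intro hsub
  have hne : ¬ (q = 0 ∧ r = 0) := by
    rintro ⟨rfl, rfl⟩
    have := hprim 0 0 (by rw [he]; module)
    omega
  have h1 : ¬ (q ≤ 0 ∧ r ≤ 0) := fun h => by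
    have := hu (-q) (-r) (by omega) (by omega) (by convert hadd using 1; rw [he]; module)
    omega
  have h2 : ¬ (0 ≤ q ∧ 0 ≤ r) := fun h => by
    have := hu q r h.1 h.2 (by convert hsub using 1; rw [he]; module)
    omega
  rcases lt_or_ge 0 q with hq | hq
  · exact not_mem_of_coneFree_of_pos hv hw hvB hwB he hprim hext hq (by omega) hadd hsub
  · exact not_mem_of_coneFree_of_pos hw.symm hv.symm hwB hvB (by rw [he, add_comm]) hprim hext
      (by omega : 0 < r) (by omega) hadd hsub

theorem coneFree_intBox_apex {k : ℕ} (hk : 2 ≤ k) {u v w : ℤ × ℤ}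
    (hu : ConeFree (intBox k) u v w) (hv : ConeFree (intBox k) v w u)
    (hw : ConeFree (intBox k) w u v) (huB : u ∈ intBox k) (hvB : v ∈ intBox k)
    (hwB : w ∈ intBox k) (hD : intDet (v - u) (w - u) = 1) :
    u.1 = 0 ∨ u.1 = k := by
  by_contra! h
  simp only [intBox, mem_ofPred_eq] at huB
  simp only [intDet, Prod.fst_sub, Prod.snd_sub] at hD
  refine not_mem_of_coneFree (e := (1, 0)) (q := w.2 - u.2) (r := u.2 - v.2)
    hu hv hw hvB hwB ?_ ?_ ?_ ?_ ?_
  · ext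
    · simp only [Prod.fst_add, Prod.smul_fst, Prod.fst_sub, smul_eq_mul]; linarith
    · simp only [Prod.snd_add, Prod.smul_snd, Prod.snd_sub, smul_eq_mul]; ring
  · intro n y hy
    have := congrArg Prod.fst hy
    exact Int.isUnit_iff.1 (IsUnit.of_mul_eq_one y.1 (by simpa using this.symm))
  · intro x hx hx'
    simp only [intBox, mem_ofPred_eq, Prod.fst_add, Prod.snd_add, Prod.fst_sub,
      Prod.snd_sub] at *
    omega
  · simp only [intBox, mem_ofPred_eq, Prod.fst_add, Prod.snd_add]; omega
  · simp only [intBox, mem_ofPred_eq, Prod.fst_sub, Prod.snd_sub]; omega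

theorem not_coneFree_intBox {k : ℕ} (hk : 2 ≤ k) {u v w : ℤ × ℤ}
    (hu : ConeFree (intBox k) u v w) (hv : ConeFree (intBox k) v w u)
    (huB : u ∈ intBox k) (hvB : v ∈ intBox k)
    (hwB : w ∈ intBox k) (hD : intDet (v - u) (w - u) = 1) :
    ¬ ConeFree (intBox k) w u v := by
  intro hw
  have key : ∀ {a b : ℤ}, (a = 0 ∨ a = k) → (b = 0 ∨ b = k) → (k : ℤ) ∣ b - a := by
    rintro a b (rfl | rfl) (rfl | rfl) <;> simp
  have hu1 := coneFree_intBox_apex hk hu hv hw huB hvB hwB hD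
  have hv1 := coneFree_intBox_apex hk hv hw hu hvB hwB huB (by
    rw [← hD]; simp only [intDet, Prod.fst_sub, Prod.snd_sub]; ring)
  have hw1 := coneFree_intBox_apex hk hw hu hv hwB huB hvB (by
    rw [← hD]; simp only [intDet, Prod.fst_sub, Prod.snd_sub]; ring)
  have hdvd : (k : ℤ) ∣ 1 := by
    rw [← hD]
    exact dvd_sub (Dvd.dvd.mul_right (key hu1 hv1) _) (Dvd.dvd.mul_left (key hu1 hw1) _)
  have := Int.le_of_dvd one_pos hdvd
  omega

theorem eq_zero_of_smul_add_smul_eq_zero {a b : ℤ × ℤ} (hD : intDet a b ≠ 0) {s t : ℤ}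
    (h : s • a + t • b = 0) : s = 0 ∧ t = 0 := by
  have h1 := congrArg Prod.fst h
  have h2 := congrArg Prod.snd h
  simp only [Prod.fst_add, Prod.snd_add, Prod.smul_fst, Prod.smul_snd, smul_eq_mul,
    Prod.fst_zero, Prod.snd_zero] at h1 h2
  constructor
  · refine (mul_eq_zero.1 (?_ : s * intDet a b = 0)).resolve_right hD
    simp only [intDet]; linear_combination b.2 * h1 - b.1 * h2
  · refine (mul_eq_zero.1 (?_ : t * intDet a b = 0)).resolve_right hD
    simp only [intDet]; linear_combination a.1 * h2 - a.2 * h1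

/-- The lattice triangle spanned by `a` and `b` has no lattice points but its vertices. -/
def EmptyTriangle (a b : ℤ × ℤ) : Prop :=
  ∀ (s t : ℤ) (z : ℤ × ℤ), 0 ≤ s → 0 ≤ t → s + t ≤ intDet a b →
    intDet a b • z = s • a + t • b → z = 0 ∨ z = a ∨ z = b

theorem EmptyTriangle.dvd {a b : ℤ × ℤ} (hD : 0 < intDet a b) (h : EmptyTriangle a b)
    {s t : ℤ} {z : ℤ × ℤ} (hz : intDet a b • z = s • a + t • b) :
    intDet a b ∣ s ∧ intDet a b ∣ t := by
  have vertex : ∀ {s t : ℤ} {z : ℤ × ℤ}, 0 ≤ s → 0 ≤ t → s + t ≤ intDet a b →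
      intDet a b • z = s • a + t • b →
      s = 0 ∧ t = 0 ∨ s = intDet a b ∧ t = 0 ∨ s = 0 ∧ t = intDet a b := by
    intro s t z hs ht hst hz
    rcases h s t z hs ht hst hz with rfl | rfl | rfl
    · exact Or.inl (eq_zero_of_smul_add_smul_eq_zero hD.ne' (by rw [← hz, smul_zero]))
    · have := eq_zero_of_smul_add_smul_eq_zero (s := s - intDet z b) (t := t) hD.ne' (by
        rw [sub_smul, hz]; module)
      omega
    · have := eq_zero_of_smul_add_smul_eq_zero (s := s) (t := t - intDet a z) hD.ne' (by
        rw [sub_smul, hz]; module)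
      omega
  set D := intDet a b
  have hs0 := Int.emod_nonneg s hD.ne'
  have ht0 := Int.emod_nonneg t hD.ne'
  have hs1 := Int.emod_lt_of_pos s hD
  have ht1 := Int.emod_lt_of_pos t hD
  have hz' : D • (z - (s / D) • a - (t / D) • b) = (s % D) • a + (t % D) • b := by
    rw [smul_sub, smul_sub, hz, Int.emod_def, Int.emod_def]; module
  rcases le_or_gt (s % D + t % D) D with hst | hst
  · have := vertex hs0 ht0 hst hz'
    exact ⟨Int.dvd_of_emod_eq_zero (by omega), Int.dvd_of_emod_eq_zero (by omega)⟩
  · have := vertex (s := D - s % D) (t := D - t % D)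
      (z := a + b - (z - (s / D) • a - (t / D) • b)) (by omega) (by omega) (by omega) (by
        rw [smul_sub, hz']; module)
    omega

theorem EmptyTriangle.intDet_eq_one {a b : ℤ × ℤ} (hD : 0 < intDet a b)
    (h : EmptyTriangle a b) : intDet a b = 1 := by
  obtain ⟨⟨b₂, hb₂⟩, ⟨a₂, ha₂⟩⟩ := h.dvd hD (s := b.2) (t := -a.2) (z := (1, 0)) (by
    ext
    · simp [intDet]; ring
    · simp; ring)
  obtain ⟨⟨b₁, hb₁⟩, ⟨a₁, ha₁⟩⟩ := h.dvd hD (s := -b.1) (t := a.1) (z := (0, 1)) (by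
    ext
    · simp; ring
    · simp [intDet]; ring)
  have hdef : intDet a b = a.1 * b.2 - a.2 * b.1 := rfl
  have hmul : intDet a b * (a₁ * b₂ - a₂ * b₁) = 1 := by
    apply mul_left_cancel₀ hD.ne'
    linear_combination (-b.2) * ha₁ - intDet a b * a₁ * hb₂ - hdef
      - b.1 * ha₂ + intDet a b * a₂ * hb₁
  rcases Int.isUnit_iff.1 (IsUnit.of_mul_eq_one _ hmul) with h | h <;> omega

theorem eq_or_eq_or_eq_of_mem_extremePoints {E : Type*} [AddCommGroup E] [Module ℝ E]
    {Q : Set E} (hQ : Convex ℝ Q) {e a b c : E} (he : e ∈ extremePoints ℝ Q)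
    (ha : a ∈ Q) (hb : b ∈ Q) (hc : c ∈ Q) (h : e ∈ convexHull ℝ {a, b, c}) :
    e = a ∨ e = b ∨ e = c := by
  have hsub : convexHull ℝ {a, b, c} ⊆ Q := convexHull_min (by
    rintro x (rfl | rfl | rfl) <;> assumption) hQ
  simpa using (extremePoints_convexHull_subset
    (inter_extremePoints_subset_extremePoints_of_subset hsub ⟨h, he⟩) : e ∈ ({a, b, c} : Set E))

theorem mem_convexHull_triple {E : Type*} [AddCommGroup E] [Module ℝ E] {e a b c : E}
    {α β γ : ℝ} (hα : 0 ≤ α) (hβ : 0 ≤ β) (hγ : 0 ≤ γ) (hsum : α + β + γ = 1)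
    (he : e = α • a + β • b + γ • c) : e ∈ convexHull ℝ {a, b, c} := by
  rw [he]
  have hconv := convex_convexHull ℝ ({a, b, c} : Set E)
  have := hconv.sum_mem (t := Finset.univ) (w := ![α, β, γ]) (z := ![a, b, c])
    (by simp [Fin.forall_fin_succ, hα, hβ, hγ]) (by simp [Fin.sum_univ_succ, ← add_assoc, hsum])
    (by
      intro i _
      apply subset_convexHull
      fin_cases i <;> simp)
  simpa [Fin.sum_univ_succ, ← add_assoc] using this

theorem intPt_injective : Function.Injective intPt := by
  intro x y h
  have h0 := congrFun h 0
  have h1 := congrFun h 1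
  simp only [intPt, Matrix.cons_val_zero, Matrix.cons_val_one, Int.cast_inj] at h0 h1
  exact Prod.ext h0 h1

theorem intPt_mem_cube {k : ℕ} {x : ℤ × ℤ} : intPt x ∈ Cube 2 k ↔ x ∈ intBox k := by
  simp only [Cube, intPt, intBox, mem_ofPred_eq, Fin.forall_fin_two, Set.mem_Icc,
    Matrix.cons_val_zero, Matrix.cons_val_one, and_assoc]
  norm_cast

theorem exists_intPt_eq {x : Pt 2} (hx : IsLatticePt 2 x) : ∃ z, intPt z = x := by
  obtain ⟨a, ha⟩ := hx 0
  obtain ⟨b, hb⟩ := hx 1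
  refine ⟨(a, b), ?_⟩
  ext i
  fin_cases i <;> simp [intPt, ha, hb]

theorem isLatticePt_intPt (z : ℤ × ℤ) : IsLatticePt 2 (intPt z) :=
  Fin.forall_fin_two.2 ⟨⟨z.1, rfl⟩, ⟨z.2, rfl⟩⟩

theorem ne_of_intDet_ne_zero {u v w : ℤ × ℤ} (hD : intDet (v - u) (w - u) ≠ 0) :
    u ≠ v ∧ u ≠ w := by
  constructor <;> rintro rfl <;> simp [intDet] at hD

theorem coneFree_of_convexIndependent {k : ℕ} {u v w : ℤ × ℤ}
    (hD : intDet (v - u) (w - u) ≠ 0)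
    (h : ∀ x ∈ intBox k, ∃ Q : Set (Pt 2), Convex ℝ Q ∧ intPt u ∈ extremePoints ℝ Q ∧
      intPt v ∈ Q ∧ intPt w ∈ Q ∧ intPt x ∈ Q) :
    ConeFree (intBox k) u v w := by
  intro m n hm hn hx
  obtain ⟨Q, hQ, hu, hv, hw, hxQ⟩ := h _ hx
  have hm' : (0 : ℝ) ≤ m := by exact_mod_cast hm
  have hn' : (0 : ℝ) ≤ n := by exact_mod_cast hn
  have hpos : (0 : ℝ) < 1 + m + n := by positivity
  have hmem := mem_convexHull_triple (e := intPt u)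
    (a := intPt (u - m • (v - u) - n • (w - u))) (b := intPt v) (c := intPt w)
    (α := 1 / (1 + m + n)) (β := m / (1 + m + n)) (γ := n / (1 + m + n))
    (by positivity) (by positivity) (by positivity) (by field_simp) (by
      ext i
      fin_cases i <;> simp [intPt] <;> field_simp <;> ring)
  obtain ⟨huv, huw⟩ := ne_of_intDet_ne_zero hD
  rcases eq_or_eq_or_eq_of_mem_extremePoints hQ hu hxQ hv hw hmem with h | h | h
  · refine eq_zero_of_smul_add_smul_eq_zero hD ?_
    have := intPt_injective h
    rw [sub_sub] at this
    exact sub_eq_self.1 this.symm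
  · exact absurd (intPt_injective h) huv
  · exact absurd (intPt_injective h) huw

theorem emptyTriangle_of_convexIndependent {k : ℕ} {u v w : ℤ × ℤ}
    (hD : 0 < intDet (v - u) (w - u)) (huB : u ∈ intBox k) (hvB : v ∈ intBox k)
    (hwB : w ∈ intBox k)
    (h : ∀ x ∈ intBox k, ∃ Q : Set (Pt 2), Convex ℝ Q ∧ intPt x ∈ extremePoints ℝ Q ∧
      intPt u ∈ Q ∧ intPt v ∈ Q ∧ intPt w ∈ Q) :
    EmptyTriangle (v - u) (w - u) := by
  intro s t z hs ht hst hz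
  set D := intDet (v - u) (w - u)
  have hs' : (0 : ℝ) ≤ s := by exact_mod_cast hs
  have ht' : (0 : ℝ) ≤ t := by exact_mod_cast ht
  have hD' : (0 : ℝ) < D := by exact_mod_cast hD
  have hst' : (0 : ℝ) ≤ D - s - t := by
    have : (s : ℝ) + t ≤ D := by exact_mod_cast hst
    linarith
  have hz1 : (D : ℝ) * z.1 = s * (v.1 - u.1) + t * (w.1 - u.1) := by
    exact_mod_cast congrArg Prod.fst hz
  have hz2 : (D : ℝ) * z.2 = s * (v.2 - u.2) + t * (w.2 - u.2) := by
    exact_mod_cast congrArg Prod.snd hz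
  have hmem := mem_convexHull_triple (e := intPt (u + z))
    (a := intPt u) (b := intPt v) (c := intPt w)
    (α := (D - s - t) / D) (β := s / D) (γ := t / D)
    (by positivity) (by positivity) (by positivity) (by field_simp; ring) (by
      ext i
      fin_cases i
      · simp [intPt]; field_simp; linear_combination hz1
      · simp [intPt]; field_simp; linear_combination hz2)
  have hcube : Convex ℝ (Cube 2 k) := by
    have : Cube 2 k = Set.univ.pi fun _ => Set.Icc (0 : ℝ) k := by
      ext; simp only [Cube, Set.mem_pi, mem_ofPred_eq, mem_univ, forall_const]
    rw [this]
    exact convex_pi fun _ _ => convex_Icc _ _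
  have hbox : u + z ∈ intBox k := intPt_mem_cube.1 (convexHull_min (by
    rintro x (rfl | rfl | rfl) <;> rwa [intPt_mem_cube]) hcube hmem)
  obtain ⟨Q, hQ, hx, hu, hv, hw⟩ := h _ hbox
  rcases eq_or_eq_or_eq_of_mem_extremePoints hQ hx hu hv hw hmem with h | h | h
  · exact Or.inl (add_eq_left.1 (intPt_injective h))
  · exact Or.inr (Or.inl (eq_sub_of_add_eq' (intPt_injective h)))
  · exact Or.inr (Or.inr (eq_sub_of_add_eq' (intPt_injective h)))

theorem exists_affine_ne_zero {V : Set (Pt 2)} (hV : affineSpan ℝ V = ⊤) {α β γ : ℝ}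
    (h : α ≠ 0 ∨ β ≠ 0) : ∃ x ∈ V, α * x 0 + β * x 1 + γ ≠ 0 := by
  by_contra! hzero
  have hall : ∀ x : Pt 2, α * x 0 + β * x 1 + γ = 0 := by
    intro x
    have hx : x ∈ affineSpan ℝ V := by rw [hV]; trivial
    refine affineSpan_induction hx hzero fun c u v w hu hv hw => ?_
    simp only [vsub_eq_sub, vadd_eq_add, Pi.add_apply, Pi.smul_apply, Pi.sub_apply, smul_eq_mul]
    linear_combination c * hu - c * hv + hw
  have h0 := hall 0
  have h1 := hall ![1, 0]
  have h2 := hall ![0, 1]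
  simp at h0 h1 h2
  rcases h with h | h
  · exact h (by linarith)
  · exact h (by linarith)

theorem exists_intDet_ne_zero {V : Set (Pt 2)} (hV : affineSpan ℝ V = ⊤)
    (hlat : ∀ x ∈ V, IsLatticePt 2 x) :
    ∃ u v w, intPt u ∈ V ∧ intPt v ∈ V ∧ intPt w ∈ V ∧ intDet (v - u) (w - u) ≠ 0 := by
  have key : ∀ {α β γ : ℝ}, (α ≠ 0 ∨ β ≠ 0) →
      ∃ z : ℤ × ℤ, intPt z ∈ V ∧ α * z.1 + β * z.2 + γ ≠ 0 := by
    intro α β γ h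
    obtain ⟨x, hx, hne⟩ := exists_affine_ne_zero hV (γ := γ) h
    obtain ⟨z, rfl⟩ := exists_intPt_eq (hlat x hx)
    exact ⟨z, hx, hne⟩
  obtain ⟨u, hu, -⟩ := key (α := 1) (β := 0) (γ := 0) (by simp)
  obtain ⟨v, hv, hne⟩ := key (α := 1) (β := 0) (γ := -u.1) (by simp)
  have hne' : (v.1 : ℝ) - u.1 ≠ 0 := fun h => hne (by linear_combination h)
  obtain ⟨w, hw, hD⟩ := key (α := -((v.2 : ℝ) - u.2)) (β := v.1 - u.1)
    (γ := (v.2 - u.2) * u.1 - (v.1 - u.1) * u.2) (Or.inr hne')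
  refine ⟨u, v, w, hu, hv, hw, fun h => hD ?_⟩
  have h' : ((v.1 : ℝ) - u.1) * (w.2 - u.2) - (v.2 - u.2) * (w.1 - u.1) = 0 := by
    exact_mod_cast h
  linear_combination h'

theorem affineSpan_extremePoints {P : Set (Pt 2)} (hP : IsPolytope 2 P) (hPd : FullDim 2 P) :
    affineSpan ℝ (extremePoints ℝ P) = ⊤ := by
  obtain ⟨S, rfl⟩ := hP
  have hfin : (extremePoints ℝ (convexHull ℝ (S : Set (Pt 2)))).Finite :=
    S.finite_toSet.subset extremePoints_convexHull_subset
  have hKM := closure_convexHull_extremePoints (S.finite_toSet.isCompact_convexHull ℝ)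
    (convex_convexHull ℝ _)
  rw [(hfin.isClosed_convexHull ℝ).closure_eq] at hKM
  rw [← affineSpan_convexHull, hKM]
  exact hPd

/-- for `k ≥ 2`, no lattice polygon contained in `[0,k]²` has the
property that every lattice point of `[0,k]²` can be inserted in it or deleted
from it: some lattice point of `[0,k]²` can neither be inserted nor deleted. -/
theorem stmt_19 (k : ℕ) (hk : 2 ≤ k) (P : Set (Pt 2))
    (hP : IsPolytope 2 P) (hPd : FullDim 2 P) (hlat : IsLatticePoly 2 P)
    (hsub : P ⊆ Cube 2 k) :
    ∃ x : Pt 2, IsLatticePt 2 x ∧ x ∈ Cube 2 k ∧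
      ¬ CanInsert 2 P x ∧ ¬ CanDelete 2 P x := by
  by_contra! hcon
  obtain ⟨u, v, w, hu, hv, hw, hD⟩ :
      ∃ u v w, intPt u ∈ extremePoints ℝ P ∧ intPt v ∈ extremePoints ℝ P ∧
        intPt w ∈ extremePoints ℝ P ∧ 0 < intDet (v - u) (w - u) := by
    obtain ⟨u, v, w, hu, hv, hw, hD⟩ :=
      exists_intDet_ne_zero (affineSpan_extremePoints hP hPd) hlat
    rcases hD.lt_or_gt with hD | hD
    · refine ⟨u, w, v, hu, hw, hv, ?_⟩
      simp only [intDet] at hD ⊢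
      linarith
    · exact ⟨u, v, w, hu, hv, hw, hD⟩
  have hext : ∀ x ∈ intBox k, ∃ Q : Set (Pt 2), Convex ℝ Q ∧
      extremePoints ℝ P ⊆ extremePoints ℝ Q ∧ intPt x ∈ extremePoints ℝ Q := by
    intro x hx
    by_cases hins : CanInsert 2 P (intPt x)
    · refine ⟨_, convex_convexHull ℝ (P ∪ {intPt x}), ?_, ?_⟩ <;> rw [hins]
      · exact subset_union_left
      · exact Or.inr rfl
    · obtain ⟨S, rfl⟩ := hP
      exact ⟨_, convex_convexHull ℝ _, Subset.rfl,
        (hcon _ (isLatticePt_intPt x) (intPt_mem_cube.2 hx) hins).1⟩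
  have hbox : ∀ {z}, intPt z ∈ extremePoints ℝ P → z ∈ intBox k := fun hz =>
    intPt_mem_cube.1 (hsub (extremePoints_subset hz))
  have hcone : ∀ {u v w : ℤ × ℤ}, intPt u ∈ extremePoints ℝ P → intPt v ∈ extremePoints ℝ P →
      intPt w ∈ extremePoints ℝ P → 0 < intDet (v - u) (w - u) → ConeFree (intBox k) u v w := by
    intro u v w hu hv hw hD
    refine coneFree_of_convexIndependent hD.ne' fun x hx => ?_
    obtain ⟨Q, hQ, hPQ, hxQ⟩ := hext x hx
    exact ⟨Q, hQ, hPQ hu, (hPQ hv).1, (hPQ hw).1, hxQ.1⟩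
  have hone := (emptyTriangle_of_convexIndependent hD (hbox hu) (hbox hv) (hbox hw)
    fun x hx => by
      obtain ⟨Q, hQ, hPQ, hxQ⟩ := hext x hx
      exact ⟨Q, hQ, hxQ, (hPQ hu).1, (hPQ hv).1, (hPQ hw).1⟩).intDet_eq_one hD
  refine not_coneFree_intBox hk (hcone hu hv hw hD) (hcone hv hw hu ?_) (hbox hu) (hbox hv)
    (hbox hw) hone (hcone hw hu hv ?_) <;>
  · simp only [intDet, Prod.fst_sub, Prod.snd_sub] at hD ⊢
    linarith
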